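/- arXiv:2012.01154 — 4 statements merged into one kernel-verified Lean document; each statement's English description precedes it below -/
import Mathlib

section
/- Let Δ > 0 be real and K a natural number. Then there exist unique real coefficients p₀, p₁, …, p_K such that the function f : ℝ → ℝ defined near 0 by f(η) = 1 + (Δ − η²)^{K + 1/2} · Σ_{h=0}^{K} p_h η^{2h} has all its derivatives of order 0, 1, …, 2K vanishing at η = 0 (equivalently, f(η) = O(η^{2K+1}) as η → 0). -/
open Real Finset

open scoped Topology

/-- Multiplying by a smooth function preserves vanishing of all derivatives up to order `n`. -/
theorem iteratedDeriv_mul_eq_zero_of_forall_le {w f : ℝ → ℝ} {x : ℝ} {n : ℕ}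
    (hw : ContDiffAt ℝ n w x) (hf : ContDiffAt ℝ n f x)
    (h : ∀ j ≤ n, iteratedDeriv j f x = 0) :
    ∀ j ≤ n, iteratedDeriv j (w * f) x = 0 := by
  intro j hj
  have hjn : (j : WithTop ℕ∞) ≤ n := by exact_mod_cast hj
  rw [iteratedDeriv_mul (hw.of_le hjn) (hf.of_le hjn)]
  exact Finset.sum_eq_zero fun i _ => by rw [h (j - i) (by omega), mul_zero]

/-- If `w * g = 1` near `x`, then `1 + w * P` and `P + g` have the same order of vanishing
at `x`. -/
theorem forall_iteratedDeriv_one_add_mul_eq_zero_iff {w g P : ℝ → ℝ} {x : ℝ} {n : ℕ}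
    (hw : ContDiffAt ℝ n w x) (hg : ContDiffAt ℝ n g x) (hP : ContDiffAt ℝ n P x)
    (hwg : ∀ᶠ y in 𝓝 x, w y * g y = 1) :
    (∀ j ≤ n, iteratedDeriv j (fun y => 1 + w y * P y) x = 0) ↔
      ∀ j ≤ n, iteratedDeriv j (P + g) x = 0 := by
  constructor
  · intro h j hj
    have heq : P + g =ᶠ[𝓝 x] g * fun y => 1 + w y * P y := by
      filter_upwards [hwg] with y hy
      simp only [Pi.add_apply, Pi.mul_apply]
      linear_combination -P y * hy
    rw [heq.iteratedDeriv_eq]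
    exact iteratedDeriv_mul_eq_zero_of_forall_le hg (contDiffAt_const.add (hw.mul hP)) h j hj
  · intro h j hj
    have heq : (fun y => 1 + w y * P y) =ᶠ[𝓝 x] w * (P + g) := by
      filter_upwards [hwg] with y hy
      simp only [Pi.add_apply, Pi.mul_apply]
      linear_combination -hy
    rw [heq.iteratedDeriv_eq]
    exact iteratedDeriv_mul_eq_zero_of_forall_le hw (hP.add hg) h j hj

/-- The odd-order derivatives of an even function vanish at the origin. -/
theorem Function.Even.iteratedDeriv_zero_of_odd {g : ℝ → ℝ} (hg : Function.Even g) {j : ℕ}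
    (hj : Odd j) : iteratedDeriv j g 0 = 0 := by
  have h := iteratedDeriv_comp_neg j g 0
  rw [funext hg, hj.neg_one_pow, neg_zero, smul_eq_mul] at h
  linarith

theorem iteratedDeriv_sum_even_pow_zero {m : ℕ} (p : Fin m → ℝ) (j : ℕ) :
    iteratedDeriv j (fun η : ℝ => ∑ h : Fin m, p h * η ^ (2 * (h : ℕ))) 0 =
      ∑ h : Fin m, if j = 2 * (h : ℕ) then p h * (2 * (h : ℕ)).factorial else 0 := by
  rw [iteratedDeriv_fun_sum fun i _ => by fun_prop]
  refine Finset.sum_congr rfl fun h _ => ?_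
  rw [iteratedDeriv_const_mul_field, iteratedDeriv_fun_pow_zero, Nat.cast_ite, mul_ite, Nat.cast_zero,
    mul_zero]

/-- An even function has a unique even polynomial of degree at most `2 * K` cancelling its
derivatives at the origin through order `2 * K`. -/
theorem existsUnique_even_poly_add_iteratedDeriv_eq_zero {K : ℕ} {g : ℝ → ℝ}
    (heven : Function.Even g) (hg : ContDiffAt ℝ (2 * K : ℕ) g 0) :
    ∃! p : Fin (K + 1) → ℝ, ∀ j ≤ 2 * K,
      iteratedDeriv j ((fun η : ℝ => ∑ h : Fin (K + 1), p h * η ^ (2 * (h : ℕ))) + g) 0 = 0 := by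
  have hadd (p : Fin (K + 1) → ℝ) (j : ℕ) (hj : j ≤ 2 * K) :
      iteratedDeriv j ((fun η : ℝ => ∑ h : Fin (K + 1), p h * η ^ (2 * (h : ℕ))) + g) 0 =
        (∑ h : Fin (K + 1), if j = 2 * (h : ℕ) then p h * (2 * (h : ℕ)).factorial else 0) +
          iteratedDeriv j g 0 := by
    rw [iteratedDeriv_add (by fun_prop) (hg.of_le (by exact_mod_cast hj)),
      iteratedDeriv_sum_even_pow_zero]
  have hcoeff (p : Fin (K + 1) → ℝ) (k : Fin (K + 1)) :
      (∑ h : Fin (K + 1),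
        if 2 * (k : ℕ) = 2 * (h : ℕ) then p h * (2 * (h : ℕ)).factorial else 0) =
        p k * (2 * (k : ℕ)).factorial := by
    rw [Finset.sum_eq_single k _ (by simp), if_pos rfl]
    intro b _ hb
    rw [if_neg]
    intro h
    exact hb (Fin.ext (by omega))
  refine ⟨fun k => -iteratedDeriv (2 * (k : ℕ)) g 0 / (2 * (k : ℕ)).factorial, ?_, ?_⟩
  · intro j hj
    rw [hadd _ j hj]
    rcases Nat.even_or_odd' j with ⟨k, rfl | rfl⟩
    · rw [hcoeff _ ⟨k, by omega⟩, div_mul_cancel₀ _ (by positivity), neg_add_cancel]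
    · rw [heven.iteratedDeriv_zero_of_odd (odd_two_mul_add_one k), add_zero]
      exact Finset.sum_eq_zero fun h _ => if_neg (by omega)
  · intro q hq
    funext k
    have h := hq (2 * (k : ℕ)) (by omega)
    rw [hadd _ _ (by omega), hcoeff] at h
    rw [eq_div_iff (by positivity)]
    linarith

/-- There exist unique coefficients `p₀, …, p_K` such that
`f(η) = 1 + (Δ − η²)^(K + 1/2) · ∑ h, p h · η^(2h)` has all derivatives of order
`0, 1, …, 2K` vanishing at `η = 0`. -/
theorem existsUnique_coeffs_vanishing_derivs (Δ : ℝ) (hΔ : 0 < Δ) (K : ℕ) :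
    ∃! p : Fin (K + 1) → ℝ,
      ∀ j ≤ 2 * K,
        iteratedDeriv j
          (fun η : ℝ =>
            1 + (Δ - η ^ 2) ^ ((K : ℝ) + 1 / 2) * ∑ h : Fin (K + 1), p h * η ^ (2 * (h : ℕ)))
          0 = 0 := by
  have hbase (s : ℝ) : ContDiffAt ℝ (2 * K : ℕ) (fun η : ℝ => (Δ - η ^ 2) ^ s) 0 :=
    ContDiffAt.rpow_const_of_ne (by fun_prop) (by simpa using hΔ.ne')
  have hinv : ∀ᶠ η : ℝ in 𝓝 0,
      (Δ - η ^ 2) ^ ((K : ℝ) + 1 / 2) * (Δ - η ^ 2) ^ (-((K : ℝ) + 1 / 2)) = 1 := by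
    have hcont : ContinuousAt (fun η : ℝ => Δ - η ^ 2) 0 := by fun_prop
    filter_upwards [hcont.eventually (lt_mem_nhds (by simpa using hΔ))] with η hη
    rw [← rpow_add hη, add_neg_cancel, rpow_zero]
  have heven : Function.Even fun η : ℝ => (Δ - η ^ 2) ^ (-((K : ℝ) + 1 / 2)) := fun η => by
    simp only [neg_sq]
  refine (existsUnique_congr fun p => ?_).mpr
    (existsUnique_even_poly_add_iteratedDeriv_eq_zero heven (hbase _))
  exact forall_iteratedDeriv_one_add_mul_eq_zero_iff (hbase _) (hbase _) (by fun_prop) hinv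
end

section
/- Let a < b be reals, Δ = b − a, and K a natural number. Let p₊ and p₋ be real polynomial functions (of degree at most 2K+1). Let P_L and P_R be real polynomial functions such that both functions t ↦ 1 + (Δ − t²)^{K+1/2} P_L(t) and t ↦ 1 + (Δ − t²)^{K+1/2} P_R(t) have all derivatives of order 0, 1, …, 2K vanishing at t = 0. Define, for r ∈ (a, b), g(r) = [1 + (r − a)^{K+1/2} P_L(√(b − r))] · p₊(√(r − a)) + [1 + (b − r)^{K+1/2} P_R(√(r − a))] · p₋(√(b − r)). Then g(r) − p₊(√(r − a)) = O((r − a)^{K + 1/2}) as r → a from the right, and g(r) − p₋(√(b − r)) = O((b − r)^{K + 1/2}) as r → b from the left. -/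
open Real Asymptotics Topology Polynomial

/-- An analytic function whose derivatives of order less than `n` vanish at `x` is
`O((t - x) ^ n)` near `x`. -/
theorem AnalyticAt.isBigO_pow_of_iteratedDeriv_eq_zero {f : ℝ → ℝ} {x : ℝ} {n : ℕ}
    (hf : AnalyticAt ℝ f x) (h : ∀ j < n, iteratedDeriv j f x = 0) :
    f =O[𝓝 x] fun t => (t - x) ^ n := by
  obtain ⟨q, hq, hfq⟩ := (natCast_le_analyticOrderAt hf).1
    ((natCast_le_analyticOrderAt_iff_iteratedDeriv_eq_zero hf).2 h)
  refine Filter.EventuallyEq.trans_isBigO hfq ?_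
  simpa using (isBigO_refl (fun t : ℝ => (t - x) ^ n) (𝓝 x)).mul
    (hq.continuousAt.tendsto.isBigO_one ℝ)

theorem analyticAt_one_add_rpow_mul_eval {d : ℝ} (hd : d ≠ 0) (s : ℝ) (Q : ℝ[X]) :
    AnalyticAt ℝ (fun t : ℝ => 1 + (d - t ^ 2) ^ s * Q.eval t) 0 := by
  refine ContDiffAt.analyticAt (contDiffAt_const.add (ContDiffAt.mul ?_ ?_))
  · exact ContDiffAt.rpow_const_of_ne (by fun_prop) (by simpa using hd)
  · exact Q.contDiff_aeval (𝕜 := ℝ) _ |>.contDiffAt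

theorem Real.sqrt_pow_two_mul_add_one {s : ℝ} (hs : 0 ≤ s) (K : ℕ) :
    √s ^ (2 * K + 1) = s ^ ((K : ℝ) + 1 / 2) := by
  rw [Real.sqrt_eq_rpow, ← Real.rpow_mul_natCast hs]
  congr 1
  push_cast
  ring

/-- The one-sided estimate, in terms of the distance `s` to the endpoint of an interval of
length `d`. -/
theorem isBigO_corrected_sum_sub {d : ℝ} (hd : 0 < d) (K : ℕ) (A B P Q : ℝ[X])
    (hQ : ∀ j ≤ 2 * K,
      iteratedDeriv j (fun t : ℝ => 1 + (d - t ^ 2) ^ ((K : ℝ) + 1 / 2) * Q.eval t) 0 = 0) :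
    (fun s : ℝ => (1 + s ^ ((K : ℝ) + 1 / 2) * P.eval √(d - s)) * A.eval √s +
        (1 + (d - s) ^ ((K : ℝ) + 1 / 2) * Q.eval √s) * B.eval √(d - s) - A.eval √s)
      =O[𝓝[>] 0] fun s => s ^ ((K : ℝ) + 1 / 2) := by
  have hbdd (F : ℝ → ℝ) (hF : Continuous F) : F =O[𝓝[>] 0] fun _ => (1 : ℝ) :=
    (hF.tendsto 0).mono_left nhdsWithin_le_nhds |>.isBigO_one ℝ
  have hsqrt : Filter.Tendsto Real.sqrt (𝓝[>] 0) (𝓝 0) := by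
    simpa using (Real.continuous_sqrt.tendsto 0).mono_left nhdsWithin_le_nhds
  have hfactor : (fun s : ℝ => 1 + (d - s) ^ ((K : ℝ) + 1 / 2) * Q.eval √s)
      =O[𝓝[>] 0] fun s => s ^ ((K : ℝ) + 1 / 2) := by
    refine (((analyticAt_one_add_rpow_mul_eval hd.ne' _ Q).isBigO_pow_of_iteratedDeriv_eq_zero
      fun j hj => hQ j (Nat.lt_succ_iff.1 hj)).comp_tendsto hsqrt).congr' ?_ ?_
    · filter_upwards [self_mem_nhdsWithin] with s hs
      simp [Real.sq_sqrt (le_of_lt hs)]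
    · filter_upwards [self_mem_nhdsWithin] with s hs
      simpa using Real.sqrt_pow_two_mul_add_one (le_of_lt hs) K
  have hfirst := (isBigO_refl (fun s : ℝ => s ^ ((K : ℝ) + 1 / 2)) (𝓝[>] 0)).mul
    (hbdd (fun s => P.eval √(d - s) * A.eval √s) (by fun_prop))
  have hsecond := hfactor.mul (hbdd (fun s => B.eval √(d - s)) (by fun_prop))
  simp only [mul_one] at hfirst hsecond
  refine (hfirst.add hsecond).congr_left fun s => ?_
  ring

/-- Two-sided interpolation property of the approximant `Γ''_{i,K}`: with
`ξ = √(r − a)`, `η = √(b − r)`, the function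
`g(r) = [1 + (r−a)^(K+1/2) P_L(η)] p₊(ξ) + [1 + (b−r)^(K+1/2) P_R(ξ)] p₋(η)`
agrees with `p₊(ξ)` up to `O((r−a)^(K+1/2))` as `r → a⁺` and with `p₋(η)` up to
`O((b−r)^(K+1/2))` as `r → b⁻`. -/
theorem interpolation_two_sided (a b : ℝ) (hab : a < b) (K : ℕ)
    (Pp Pm : Polynomial ℝ) (hPp : Pp.natDegree ≤ 2 * K + 1) (hPm : Pm.natDegree ≤ 2 * K + 1)
    (PL PR : Polynomial ℝ)
    (hPL : ∀ j ≤ 2 * K,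
      iteratedDeriv j
        (fun t : ℝ => 1 + ((b - a) - t ^ 2) ^ ((K : ℝ) + 1 / 2) * PL.eval t) 0 = 0)
    (hPR : ∀ j ≤ 2 * K,
      iteratedDeriv j
        (fun t : ℝ => 1 + ((b - a) - t ^ 2) ^ ((K : ℝ) + 1 / 2) * PR.eval t) 0 = 0)
    (g : ℝ → ℝ)
    (hg : ∀ r ∈ Set.Ioo a b,
      g r = (1 + (r - a) ^ ((K : ℝ) + 1 / 2) * PL.eval (Real.sqrt (b - r))) *
              Pp.eval (Real.sqrt (r - a)) +
            (1 + (b - r) ^ ((K : ℝ) + 1 / 2) * PR.eval (Real.sqrt (r - a))) *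
              Pm.eval (Real.sqrt (b - r))) :
    (fun r => g r - Pp.eval (Real.sqrt (r - a))) =O[𝓝[>] a]
        (fun r => (r - a) ^ ((K : ℝ) + 1 / 2)) ∧
    (fun r => g r - Pm.eval (Real.sqrt (b - r))) =O[𝓝[<] b]
        (fun r => (b - r) ^ ((K : ℝ) + 1 / 2)) := by
  have hd : 0 < b - a := sub_pos.2 hab
  constructor
  · have hlim : Filter.Tendsto (fun r => r - a) (𝓝[>] a) (𝓝[>] 0) := by
      refine tendsto_nhdsWithin_iff.2 ⟨?_, ?_⟩
      · exact ((continuous_sub_right a).tendsto' a 0 (sub_self a)).mono_left nhdsWithin_le_nhds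
      · filter_upwards [self_mem_nhdsWithin] with r hr using sub_pos.2 (Set.mem_Ioi.1 hr)
    refine ((isBigO_corrected_sum_sub hd K Pp Pm PL PR hPR).comp_tendsto hlim).congr' ?_ .rfl
    filter_upwards [Ioo_mem_nhdsGT hab] with r hr
    simp only [Function.comp_apply, hg r hr, sub_sub_sub_cancel_right]
  · have hlim : Filter.Tendsto (fun r => b - r) (𝓝[<] b) (𝓝[>] 0) := by
      refine tendsto_nhdsWithin_iff.2 ⟨?_, ?_⟩
      · exact ((continuous_sub_left b).tendsto' b 0 (sub_self b)).mono_left nhdsWithin_le_nhds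
      · filter_upwards [self_mem_nhdsWithin] with r hr using sub_pos.2 (Set.mem_Iio.1 hr)
    refine ((isBigO_corrected_sum_sub hd K Pm Pp PR PL hPL).comp_tendsto hlim).congr' ?_ .rfl
    filter_upwards [Ioo_mem_nhdsLT hab] with r hr
    simp only [Function.comp_apply, hg r hr, sub_sub_sub_cancel_left]
    ring
end

section
/- Let a < b be reals and K a natural number, and set w(y) = (y − a)^{K+1} (b − y)^{K+1}. For every pair (c₀, c₁) ∈ ℝ² there exists a unique pair (α, β) ∈ ℝ² such that the function F(r) = ∫_a^r (∫_a^x w(y)(α + β y) dy) dx satisfies F(b) = c₀ and F'(b) = c₁. -/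
open intervalIntegral

/-- Cauchy's formula for repeated integration, for two integrations. -/
theorem integral_integral_eq_integral_sub_mul {f : ℝ → ℝ} (hf : Continuous f) (a b : ℝ) :
    (∫ x in a..b, ∫ y in a..x, f y) = ∫ y in a..b, (b - y) * f y := by
  have key := integral_mul_deriv_eq_deriv_mul (a := a) (b := b)
    (u := fun x => ∫ y in a..x, f y) (u' := f) (v := fun x => x - b) (v' := fun _ => 1)
    (fun x _ => hf.integral_hasStrictDerivAt a x |>.hasDerivAt)
    (fun x _ => (hasDerivAt_id x).sub_const b)
    (hf.intervalIntegrable a b) intervalIntegrable_const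
  simp only [mul_one, sub_self, mul_zero, integral_same, zero_mul, zero_sub] at key
  rw [key, ← integral_neg]
  exact integral_congr fun y _ => by ring

theorem deriv_integral_integral {f : ℝ → ℝ} (hf : Continuous f) (a b : ℝ) :
    deriv (fun r => ∫ x in a..r, ∫ y in a..x, f y) b = ∫ y in a..b, f y :=
  (continuous_primitive (fun _ _ => hf.intervalIntegrable _ _) a).deriv_integral _ a b

/-- Strict Cauchy–Schwarz inequality for the moments of a positive weight. -/
theorem sq_integral_mul_lt_integral_mul_integral {w : ℝ → ℝ} (hw : Continuous w) {a b : ℝ}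
    (hab : a < b) (hpos : ∀ y ∈ Set.Ioo a b, 0 < w y) :
    (∫ y in a..b, w y * y) ^ 2 < (∫ y in a..b, w y) * ∫ y in a..b, w y * y ^ 2 := by
  have h₀ : 0 < ∫ y in a..b, w y :=
    intervalIntegral_pos_of_pos_on (hw.intervalIntegrable a b) hpos hab
  have hnonneg : ∀ y ∈ Set.Icc a b, 0 ≤ w y := by
    rw [← closure_Ioo hab.ne]
    exact fun y hy => closure_minimal (fun z hz => (hpos z hz).le)
      (isClosed_le continuous_const hw) hy
  have hvar (m : ℝ) : 0 < ∫ y in a..b, w y * (y - m) ^ 2 := by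
    obtain ⟨c, hc, hcm⟩ := (Set.Ioo_infinite hab).exists_notMem_finite (Set.finite_singleton m)
    refine integral_pos hab (by fun_prop)
      (fun y hy => mul_nonneg (hnonneg y (Set.Ioc_subset_Icc_self hy)) (sq_nonneg _))
      ⟨c, Set.Ioo_subset_Icc_self hc, mul_pos (hpos c hc) ?_⟩
    exact sq_pos_of_ne_zero (sub_ne_zero.mpr hcm)
  have hexpand (m : ℝ) : ∫ y in a..b, w y * (y - m) ^ 2 =
      (∫ y in a..b, w y * y ^ 2) - 2 * m * (∫ y in a..b, w y * y) +
        m ^ 2 * ∫ y in a..b, w y := by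
    rw [← integral_const_mul, ← integral_const_mul, ← integral_sub, ← integral_add]
    · exact integral_congr fun y _ => by ring
    all_goals exact Continuous.intervalIntegrable (by fun_prop) _ _
  have h := hvar ((∫ y in a..b, w y * y) / ∫ y in a..b, w y)
  rw [hexpand] at h
  have hscaled := mul_pos h₀ h
  field_simp at hscaled
  linarith

/-- Cramer's rule for a system of two linear equations in two unknowns. -/
theorem existsUnique_linear_system {k : Type*} [Field k] {m₁₁ m₁₂ m₂₁ m₂₂ : k}
    (hdet : m₁₁ * m₂₂ - m₁₂ * m₂₁ ≠ 0) (d₁ d₂ : k) :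
    ∃! p : k × k, p.1 * m₁₁ + p.2 * m₁₂ = d₁ ∧ p.1 * m₂₁ + p.2 * m₂₂ = d₂ := by
  refine ⟨((d₁ * m₂₂ - m₁₂ * d₂) / (m₁₁ * m₂₂ - m₁₂ * m₂₁),
    (m₁₁ * d₂ - d₁ * m₂₁) / (m₁₁ * m₂₂ - m₁₂ * m₂₁)), ⟨?_, ?_⟩, ?_⟩
  · dsimp only
    rw [div_mul_eq_mul_div, div_mul_eq_mul_div, ← add_div, div_eq_iff hdet]
    ring
  · dsimp only
    rw [div_mul_eq_mul_div, div_mul_eq_mul_div, ← add_div, div_eq_iff hdet]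
    ring
  · rintro ⟨x, y⟩ ⟨h₁, h₂⟩
    dsimp only at h₁ h₂
    rw [Prod.mk.injEq, eq_div_iff hdet, eq_div_iff hdet, ← h₁, ← h₂]
    constructor <;> ring

/-- Solvability of the matching step: for the weight `w(y) = (y−a)^(K+1) (b−y)^(K+1)`
and any prescribed value `c₀` and slope `c₁` at `r = b`, there is a unique pair
`(α, β)` such that `F(r) = ∫_a^r ∫_a^x w(y)(α + β y) dy dx` satisfies `F(b) = c₀`
and `F'(b) = c₁`. -/
theorem matching_constants_existUnique (a b : ℝ) (hab : a < b) (K : ℕ) :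
    ∀ c₀ c₁ : ℝ, ∃! p : ℝ × ℝ,
      (∫ x in a..b, ∫ y in a..x,
          (y - a) ^ (K + 1) * (b - y) ^ (K + 1) * (p.1 + p.2 * y)) = c₀ ∧
      deriv (fun r : ℝ => ∫ x in a..r, ∫ y in a..x,
          (y - a) ^ (K + 1) * (b - y) ^ (K + 1) * (p.1 + p.2 * y)) b = c₁ := by
  intro c₀ c₁
  set w : ℝ → ℝ := fun y => (y - a) ^ (K + 1) * (b - y) ^ (K + 1)
  have hw : Continuous w := by fun_prop
  have hpos : ∀ y ∈ Set.Ioo a b, 0 < w y := fun y hy =>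
    mul_pos (pow_pos (sub_pos.mpr hy.1) _) (pow_pos (sub_pos.mpr hy.2) _)
  have hdet := sq_integral_mul_lt_integral_mul_integral hw hab hpos
  have hslope (p : ℝ × ℝ) : ∫ y in a..b, w y * (p.1 + p.2 * y) =
      p.1 * (∫ y in a..b, w y) + p.2 * ∫ y in a..b, w y * y := by
    rw [← integral_const_mul, ← integral_const_mul, ← integral_add]
    · exact integral_congr fun y _ => by ring
    all_goals exact Continuous.intervalIntegrable (by fun_prop) _ _
  have hvalue (p : ℝ × ℝ) : ∫ y in a..b, (b - y) * (w y * (p.1 + p.2 * y)) =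
      b * (p.1 * (∫ y in a..b, w y) + p.2 * ∫ y in a..b, w y * y) -
        (p.1 * (∫ y in a..b, w y * y) + p.2 * ∫ y in a..b, w y * y ^ 2) := by
    rw [← hslope, ← integral_const_mul, ← integral_const_mul, ← integral_const_mul,
      ← integral_add, ← integral_sub]
    · exact integral_congr fun y _ => by ring
    all_goals exact Continuous.intervalIntegrable (by fun_prop) _ _
  have hiff (p : ℝ × ℝ) :
      ((∫ x in a..b, ∫ y in a..x, w y * (p.1 + p.2 * y)) = c₀ ∧
        deriv (fun r : ℝ => ∫ x in a..r, ∫ y in a..x, w y * (p.1 + p.2 * y)) b = c₁) ↔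
      p.1 * (∫ y in a..b, w y) + p.2 * (∫ y in a..b, w y * y) = c₁ ∧
        p.1 * (∫ y in a..b, w y * y) + p.2 * (∫ y in a..b, w y * y ^ 2) = b * c₁ - c₀ := by
    have hf : Continuous fun y => w y * (p.1 + p.2 * y) := by fun_prop
    rw [integral_integral_eq_integral_sub_mul hf, deriv_integral_integral hf, hvalue, hslope]
    constructor
    · rintro ⟨h₀, h₁⟩
      exact ⟨h₁, by rw [h₁] at h₀; linarith⟩
    · rintro ⟨h₁, h₂⟩
      exact ⟨by rw [h₁, h₂]; ring, h₁⟩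
  refine (existsUnique_congr hiff).mpr ?_
  exact existsUnique_linear_system (by rw [← sq]; exact (sub_pos.mpr hdet).ne') _ _
end

section
/- Let a ∈ (−1, 0) and D > 0 be reals. Then, as the real variable q tends to +∞, q^{a+1} · e^{−iqD} · ∫_0^D (D − x)^a e^{iqx} dx tends to Γ(a+1) · e^{−iπ(a+1)/2}, where Γ is the Gamma function and the integral is over the real interval [0, D] with complex exponential integrand. In particular, the leading asymptotic term of ∫_0^D (D − x)^a e^{iqx} dx at large q is proportional to e^{iqD} / q^{a+1}. -/
open Real Complex Filter intervalIntegral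

lemma IntervalIntegrable.ofReal_complex {f : ℝ → ℝ} {μ : MeasureTheory.Measure ℝ} {R S : ℝ}
    (hf : IntervalIntegrable f μ R S) : IntervalIntegrable (fun u => (f u : ℂ)) μ R S :=
  ⟨MeasureTheory.Integrable.ofReal hf.1, MeasureTheory.Integrable.ofReal hf.2⟩

/-- The integral of a decaying power against `exp (-z u)` over `[R, S]` is bounded by `2 R ^ a`,
uniformly in `S` and in `z` with nonnegative real part and norm at least one. -/
lemma norm_integral_rpow_mul_cexp_le {a R S : ℝ} (ha : a < 0) (hR : 0 < R) (hRS : R ≤ S)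
    {z : ℂ} (hz : 0 ≤ z.re) (hz1 : 1 ≤ ‖z‖) :
    ‖∫ u in R..S, ((u ^ a : ℝ) : ℂ) * Complex.exp (-(z * u))‖ ≤ 2 * R ^ a := by
  have hz0 : z ≠ 0 := norm_pos_iff.1 (by linarith)
  have hpos : ∀ u ∈ Set.uIcc R S, 0 < u := fun u hu => by
    rw [Set.uIcc_of_le hRS] at hu; exact hR.trans_le hu.1
  have hexp : ∀ u : ℝ, 0 < u → ‖Complex.exp (-(z * u)) / (-z)‖ ≤ 1 := fun u hu => by
    rw [norm_div, norm_neg, Complex.norm_exp]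
    refine div_le_one_of_le₀ (le_trans ?_ hz1) (norm_nonneg _)
    rw [Real.exp_le_one_iff]
    simpa using mul_nonneg hz hu.le
  have hpow : ∀ u ∈ Set.uIcc R S, HasDerivAt (fun u : ℝ => u ^ a) (a * u ^ (a - 1)) u :=
    fun u hu => Real.hasDerivAt_rpow_const (Or.inl (hpos u hu).ne')
  have hprim : ∀ u ∈ Set.uIcc R S,
      HasDerivAt (fun u : ℝ => Complex.exp (-(z * u)) / (-z)) (Complex.exp (-(z * u))) u :=
    fun u _ => by
      have h := ((((hasDerivAt_id u).ofReal_comp).const_mul z).neg.cexp).div_const (-z)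
      refine h.congr_deriv ?_
      simp [hz0]
  have hint : IntervalIntegrable (fun u : ℝ => a * u ^ (a - 1)) MeasureTheory.volume R S :=
    (ContinuousOn.intervalIntegrable fun u hu =>
      (Real.continuousAt_rpow_const u (a - 1) (Or.inl (hpos u hu).ne')).continuousWithinAt).const_mul a
  rw [integral_mul_deriv_eq_deriv_mul (fun u hu => (hpow u hu).ofReal_comp) hprim hint.ofReal_complex
    (Continuous.intervalIntegrable (by fun_prop) _ _)]
  have hbound : ‖∫ u in R..S, ((a * u ^ (a - 1) : ℝ) : ℂ) * (Complex.exp (-(z * u)) / (-z))‖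
      ≤ R ^ a - S ^ a := by
    have hval : ∫ u in R..S, -(a * u ^ (a - 1)) = R ^ a - S ^ a := by
      rw [intervalIntegral.integral_neg, integral_eq_sub_of_hasDerivAt hpow hint]; ring
    rw [← hval]
    refine norm_integral_le_of_norm_le hRS (MeasureTheory.ae_of_all _ fun u hu => ?_) hint.neg
    have hu0 : 0 < u := hR.trans hu.1
    rw [norm_mul, Complex.norm_real, Real.norm_eq_abs,
      abs_of_nonpos (mul_nonpos_of_nonpos_of_nonneg ha.le (by positivity))]
    exact mul_le_of_le_one_right
      (neg_nonneg.2 (mul_nonpos_of_nonpos_of_nonneg ha.le (by positivity))) (hexp u hu0)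
  have hend : ∀ u : ℝ, 0 < u →
      ‖((u ^ a : ℝ) : ℂ) * (Complex.exp (-(z * u)) / (-z))‖ ≤ u ^ a := fun u hu => by
    rw [norm_mul, Complex.norm_real, Real.norm_eq_abs, abs_of_nonneg (by positivity)]
    exact mul_le_of_le_one_right (by positivity) (hexp u hu)
  refine (norm_sub_le _ _).trans ((add_le_add (norm_sub_le _ _) hbound).trans ?_)
  linarith [hend R hR, hend S (hR.trans_le hRS)]

lemma intervalIntegrable_rpow_mul_cexp {a : ℝ} (ha : -1 < a) (z : ℂ) (R S : ℝ) :
    IntervalIntegrable (fun u : ℝ => ((u ^ a : ℝ) : ℂ) * Complex.exp (-(z * u)))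
      MeasureTheory.volume R S :=
  (intervalIntegrable_rpow' ha).ofReal_complex.mul_continuousOn (by fun_prop)

lemma integrableOn_rpow_mul_cexp_Ioi {a : ℝ} (ha : -1 < a) {z : ℂ} (hz : 0 < z.re) :
    MeasureTheory.IntegrableOn
      (fun u : ℝ => ((u ^ a : ℝ) : ℂ) * Complex.exp (-(z * u))) (Set.Ioi 0) := by
  refine (integrableOn_rpow_mul_exp_neg_mul_rpow ha one_pos hz).mono' ?_ ?_
  · exact Measurable.aestronglyMeasurable (by fun_prop)
  · refine MeasureTheory.ae_restrict_of_forall_mem measurableSet_Ioi fun u hu => ?_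
    have hu0 : 0 < u := hu
    rw [norm_mul, Complex.norm_real, Real.norm_eq_abs, abs_of_nonneg (by positivity),
      Complex.norm_exp]
    simp

lemma differentiableAt_integral_rpow_mul_cexp_Ioi {a : ℝ} (ha : -1 < a) {z : ℂ}
    (hz : 0 < z.re) :
    DifferentiableAt ℂ
      (fun w : ℂ => ∫ u in Set.Ioi (0 : ℝ), ((u ^ a : ℝ) : ℂ) * Complex.exp (-(w * u))) z := by
  have hs : {w : ℂ | z.re / 2 < w.re} ∈ nhds z :=
    (isOpen_lt continuous_const Complex.continuous_re).mem_nhds (half_lt_self hz)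
  refine (_root_.hasDerivAt_integral_of_dominated_loc_of_deriv_le hs
    (μ := MeasureTheory.volume.restrict (Set.Ioi (0 : ℝ)))
    (F := fun w (u : ℝ) => ((u ^ a : ℝ) : ℂ) * Complex.exp (-(w * u)))
    (F' := fun w u => ((u ^ a : ℝ) : ℂ) * (Complex.exp (-(w * u)) * -u))
    (bound := fun u => u ^ (a + 1) * Real.exp (-(z.re / 2) * u ^ (1 : ℝ)))
    (Eventually.of_forall fun w => Measurable.aestronglyMeasurable (by fun_prop))
    (integrableOn_rpow_mul_cexp_Ioi ha hz) (Measurable.aestronglyMeasurable (by fun_prop)) ?_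
    (integrableOn_rpow_mul_exp_neg_mul_rpow (by linarith) one_pos (half_pos hz))
    (MeasureTheory.ae_of_all _ fun u w _ => ?_)).2.differentiableAt
  · refine MeasureTheory.ae_restrict_of_forall_mem measurableSet_Ioi fun u hu w hw => ?_
    have hu0 : 0 < u := hu
    have hw' : z.re / 2 < w.re := hw
    rw [norm_mul, norm_mul, norm_neg, Complex.norm_real, Complex.norm_real, Real.norm_eq_abs,
      Real.norm_eq_abs, abs_of_pos hu0, abs_of_nonneg (by positivity), Complex.norm_exp,
      Real.rpow_add hu0, Real.rpow_one, mul_comm (Real.exp _), ← mul_assoc]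
    gcongr
    simpa using mul_le_mul_of_nonneg_right hw'.le hu0.le
  · refine (((hasDerivAt_id w).mul_const (u : ℂ)).neg.cexp.const_mul _).congr_deriv ?_
    simp

/-- The Gamma integral with a complex rate `z` in the right half plane. -/
lemma integral_rpow_mul_cexp_Ioi {a : ℝ} (ha : -1 < a) {z : ℂ} (hz : 0 < z.re) :
    ∫ u in Set.Ioi (0 : ℝ), ((u ^ a : ℝ) : ℂ) * Complex.exp (-(z * u)) =
      (1 / z) ^ ((a : ℂ) + 1) * Complex.Gamma (a + 1) := by
  have hU : IsOpen {w : ℂ | 0 < w.re} := isOpen_lt continuous_const Complex.continuous_re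
  have hleft : DifferentiableOn ℂ
      (fun w : ℂ => ∫ u in Set.Ioi (0 : ℝ), ((u ^ a : ℝ) : ℂ) * Complex.exp (-(w * u)))
      {w : ℂ | 0 < w.re} := fun w hw =>
    (differentiableAt_integral_rpow_mul_cexp_Ioi ha hw).differentiableWithinAt
  have hright : DifferentiableOn ℂ
      (fun w : ℂ => (1 / w) ^ ((a : ℂ) + 1) * Complex.Gamma (a + 1)) {w : ℂ | 0 < w.re} := by
    intro w hw
    have hw' : 0 < w.re := hw
    have hw0 : w ≠ 0 := fun h => by simp [h] at hw'
    have hslit : 1 / w ∈ Complex.slitPlane := by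
      refine Or.inl ?_
      rw [one_div, Complex.inv_re]
      exact div_pos hw' (Complex.normSq_pos.2 hw0)
    exact ((((differentiableAt_const _).div differentiableAt_id hw0).cpow_const
      hslit).mul_const _).differentiableWithinAt
  refine (hleft.analyticOnNhd hU).eqOn_of_preconnected_of_frequently_eq
    (hright.analyticOnNhd hU) (convex_halfSpace_re_gt 0).isPreconnected
    (z₀ := ((1 : ℝ) : ℂ)) (by simp) ?_ hz
  have hreal : Tendsto (fun r : ℝ => (r : ℂ)) (nhdsWithin 1 {1}ᶜ)
      (nhdsWithin ((1 : ℝ) : ℂ) {((1 : ℝ) : ℂ)}ᶜ) :=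
    Complex.continuous_ofReal.continuousWithinAt.tendsto_nhdsWithin fun r hr => by
      simpa using hr
  refine hreal.frequently (Eventually.frequently ?_)
  filter_upwards [nhdsWithin_le_nhds (lt_mem_nhds one_pos)] with r hr
  rw [← Complex.integral_cpow_mul_exp_neg_mul_Ioi (by simpa using by linarith) hr]
  refine MeasureTheory.setIntegral_congr_fun measurableSet_Ioi fun u hu => ?_
  simp only [add_sub_cancel_right, Complex.ofReal_cpow (le_of_lt hu)]

/-- Truncating the Gamma integral `∫ u ^ a exp (-z u)` at `R` costs at most `2 R ^ a`. -/
lemma norm_integral_rpow_mul_cexp_sub_Gamma_le {a R : ℝ} (ha : a ∈ Set.Ioo (-1 : ℝ) 0)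
    (hR : 0 < R) {z : ℂ} (hz : 0 < z.re) (hz1 : 1 ≤ ‖z‖) :
    ‖(1 / z) ^ ((a : ℂ) + 1) * Complex.Gamma (a + 1) -
      ∫ u in (0 : ℝ)..R, ((u ^ a : ℝ) : ℂ) * Complex.exp (-(z * u))‖ ≤ 2 * R ^ a := by
  have hlim := MeasureTheory.intervalIntegral_tendsto_integral_Ioi 0
    (integrableOn_rpow_mul_cexp_Ioi ha.1 hz) tendsto_id
  rw [integral_rpow_mul_cexp_Ioi ha.1 hz] at hlim
  refine le_of_tendsto (hlim.sub_const _).norm ?_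
  filter_upwards [eventually_ge_atTop R] with S hS
  rw [id, integral_interval_sub_left (intervalIntegrable_rpow_mul_cexp ha.1 z _ _)
    (intervalIntegrable_rpow_mul_cexp ha.1 z _ _)]
  exact norm_integral_rpow_mul_cexp_le ha.2 hR hS hz.le hz1

/-- The improper Fresnel-type integral `∫ u ^ a exp (-i u)` over `(0, ∞)`. -/
lemma tendsto_integral_rpow_mul_cexp_neg_I {a : ℝ} (ha : a ∈ Set.Ioo (-1 : ℝ) 0) :
    Tendsto (fun R : ℝ => ∫ u in (0 : ℝ)..R, ((u ^ a : ℝ) : ℂ) * Complex.exp (-(Complex.I * u)))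
      atTop (nhds ((1 / Complex.I) ^ ((a : ℂ) + 1) * Complex.Gamma (a + 1))) := by
  have hbound : ∀ R : ℝ, 0 < R → ‖(1 / Complex.I) ^ ((a : ℂ) + 1) * Complex.Gamma (a + 1) -
      ∫ u in (0 : ℝ)..R, ((u ^ a : ℝ) : ℂ) * Complex.exp (-(Complex.I * u))‖ ≤ 2 * R ^ a := by
    intro R hR
    have hz : Tendsto (fun ε : ℝ => (ε : ℂ) + Complex.I) (nhdsWithin 0 (Set.Ioi 0))
        (nhds Complex.I) := by
      have h : Continuous fun ε : ℝ => (ε : ℂ) + Complex.I := by fun_prop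
      simpa using (h.tendsto 0).mono_left nhdsWithin_le_nhds
    have hpow : Tendsto (fun ε : ℝ => (1 / ((ε : ℂ) + Complex.I)) ^ ((a : ℂ) + 1))
        (nhdsWithin 0 (Set.Ioi 0)) (nhds ((1 / Complex.I) ^ ((a : ℂ) + 1))) := by
      refine (tendsto_const_nhds.div hz Complex.I_ne_zero).cpow tendsto_const_nhds ?_
      simp [Complex.mem_slitPlane_iff]
    have hint : Tendsto (fun ε : ℝ => ∫ u in (0 : ℝ)..R,
        ((u ^ a : ℝ) : ℂ) * Complex.exp (-(((ε : ℂ) + Complex.I) * u)))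
        (nhdsWithin 0 (Set.Ioi 0))
        (nhds (∫ u in (0 : ℝ)..R, ((u ^ a : ℝ) : ℂ) * Complex.exp (-(Complex.I * u)))) := by
      refine tendsto_integral_filter_of_dominated_convergence (fun u => u ^ a) ?_ ?_
        (intervalIntegrable_rpow' ha.1) ?_
      · exact Eventually.of_forall fun ε => Measurable.aestronglyMeasurable (by fun_prop)
      · filter_upwards [self_mem_nhdsWithin] with ε hε
        refine MeasureTheory.ae_of_all _ fun u hu => ?_
        rw [Set.uIoc_of_le hR.le] at hu
        have hu0 : 0 < u := hu.1
        rw [norm_mul, Complex.norm_real, Real.norm_eq_abs, abs_of_nonneg (by positivity),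
          Complex.norm_exp]
        refine mul_le_of_le_one_right (by positivity) (Real.exp_le_one_iff.2 ?_)
        simpa using mul_nonneg (le_of_lt hε) hu0.le
      · exact MeasureTheory.ae_of_all _ fun u _ => ((hz.mul_const _).neg.cexp).const_mul _
    refine le_of_tendsto ((hpow.mul_const _).sub hint).norm ?_
    filter_upwards [self_mem_nhdsWithin] with ε hε
    refine norm_integral_rpow_mul_cexp_sub_Gamma_le ha hR (by simpa using hε) ?_
    simpa using Complex.abs_im_le_norm ((ε : ℂ) + Complex.I)
  have hzero : Tendsto (fun R : ℝ => 2 * R ^ a) atTop (nhds 0) := by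
    simpa using (tendsto_rpow_neg_atTop (neg_pos.2 ha.2)).const_mul 2
  rw [tendsto_iff_norm_sub_tendsto_zero]
  refine squeeze_zero' (Eventually.of_forall fun _ => norm_nonneg _) ?_ hzero
  filter_upwards [eventually_gt_atTop 0] with R hR
  rw [norm_sub_rev]
  exact hbound R hR

/-- The substitution `u = q (D - x)` in the end-point integral. -/
lemma rpow_mul_cexp_mul_integral_eq (a : ℝ) {D q : ℝ} (hD : 0 < D) (hq : 0 < q) :
    ((q ^ (a + 1) : ℝ) : ℂ) * Complex.exp (-(Complex.I * q * D)) *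
        ∫ x in (0:ℝ)..D, (((D - x) ^ a : ℝ) : ℂ) * Complex.exp (Complex.I * q * x) =
      ∫ u in (0 : ℝ)..(q * D), ((u ^ a : ℝ) : ℂ) * Complex.exp (-(Complex.I * u)) := by
  have hscale := smul_integral_comp_mul_left
    (f := fun u : ℝ => ((u ^ a : ℝ) : ℂ) * Complex.exp (-(Complex.I * u))) (a := 0) (b := D) q
  have hrefl := integral_comp_sub_left
    (fun y : ℝ => ((y ^ a : ℝ) : ℂ) * Complex.exp (Complex.I * q * (D - y))) (a := 0) (b := D) D
  simp only [Complex.ofReal_sub, sub_sub_cancel, sub_self, sub_zero] at hrefl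
  rw [mul_zero, Complex.real_smul] at hscale
  rw [hrefl, ← hscale, ← integral_const_mul, ← integral_const_mul]
  refine integral_congr fun y hy => ?_
  rw [Set.uIcc_of_le hD.le] at hy
  have hexp : Complex.exp (-(Complex.I * (q * y : ℝ))) =
      Complex.exp (-(Complex.I * q * D)) * Complex.exp (Complex.I * q * (D - y)) := by
    rw [← Complex.exp_add]
    push_cast
    ring_nf
  simp only [hexp, Real.mul_rpow hq.le hy.1, Real.rpow_add hq, Real.rpow_one]
  push_cast
  ring

/-- Erdélyi end-point asymptotics: for `−1 < a < 0` and `D > 0`,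
`q^(a+1) e^{−iqD} ∫_0^D (D − x)^a e^{iqx} dx → Γ(a+1) e^{−iπ(a+1)/2}` as `q → +∞`. -/
theorem erdelyi_endpoint_asymptotics (a D : ℝ) (ha : a ∈ Set.Ioo (-1 : ℝ) 0) (hD : 0 < D) :
    Tendsto
      (fun q : ℝ =>
        ((q ^ (a + 1) : ℝ) : ℂ) * Complex.exp (-(Complex.I * q * D)) *
          ∫ x in (0:ℝ)..D, (((D - x) ^ a : ℝ) : ℂ) * Complex.exp (Complex.I * q * x))
      atTop
      (nhds ((Real.Gamma (a + 1) : ℂ) *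
        Complex.exp (-(Complex.I * Real.pi * (a + 1) / 2)))) := by
  have hconst : (1 / Complex.I) ^ ((a : ℂ) + 1) * Complex.Gamma (a + 1) =
      (Real.Gamma (a + 1) : ℂ) * Complex.exp (-(Complex.I * Real.pi * (a + 1) / 2)) := by
    rw [← Complex.Gamma_ofReal, one_div, Complex.inv_I,
      Complex.cpow_def_of_ne_zero (neg_ne_zero.2 Complex.I_ne_zero), Complex.log_neg_I, mul_comm]
    push_cast
    ring_nf
  rw [← hconst]
  refine ((tendsto_integral_rpow_mul_cexp_neg_I ha).comp
    (tendsto_id.atTop_mul_const hD)).congr' ?_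
  filter_upwards [eventually_gt_atTop 0] with q hq
  exact (rpow_mul_cexp_mul_integral_eq a hD hq).symm
end
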